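/- Fix ω ∈ (0,2π), λ ∈ ℤ∖{0} and ℓ, n ∈ ℕ. Let α_n ∈ ℝ and β_n, γ_n ∈ ℂ, and let (f_n, g_n, h_n) be the generic data: f_n(z) = α_n z^{λ−2−ℓ} z̄^{ℓ} log^{n} z on S₋; g_n equal to β_n z^{λ−1} log^{n} z on the ray arg z = ω/2 and to β̄_n z^{λ−1} log^{n} z on arg z = −ω/2; h_n equal to γ_n z̄^{λ−1} log^{n} z̄ on arg z = ω/2 and to γ̄_n z̄^{λ−1} log^{n} z̄ on arg z = −ω/2. Then there exists a pair (V_n, W_n) ∈ 𝕊^{λ}_{ℓ+1,n+1} solving the transmission problem: ∂_z∂_{z̄} V_n = f_n in S₋, ∂_{z₊}∂_{z̄₊} W_n = 0 in S₊, ∂_z V_n + ∂_{z₊} W_n = g_n on Γ, and ∂_{z̄} V_n + ∂_{z̄₊} W_n = h_n on Γ. -/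

import Mathlib

open Complex ComplexConjugate Filter Set
open scoped Real

noncomputable section

/-- The Wirtinger derivative `∂_z f = ½(∂_x f − i ∂_y f)`. -/
def wdz (f : ℂ → ℂ) (z : ℂ) : ℂ :=
  (fderiv ℝ f z 1 - I * fderiv ℝ f z I) / 2

/-- The Wirtinger derivative `∂_{z̄} f = ½(∂_x f + i ∂_y f)`. -/
def wdzbar (f : ℂ → ℂ) (z : ℂ) : ℂ :=
  (fderiv ℝ f z 1 + I * fderiv ℝ f z I) / 2

/-- The open sector `S₋ = {r e^{iθ} : r > 0, |θ| < ω/2}`. -/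
def Sminus (ω : ℝ) : Set ℂ := {z | z ≠ 0 ∧ |z.arg| < ω / 2}

/-- The open sector of the variable `z₊ = −z`, i.e. `{z₊ ≠ 0 : |arg z₊| < π − ω/2}`,
corresponding to the interior of `S₊`. -/
def SplusVar (ω : ℝ) : Set ℂ := {z | z ≠ 0 ∧ |z.arg| < π - ω / 2}

/-- The common boundary `Γ = {r e^{±iω/2} : r > 0}`. -/
def Gam (ω : ℝ) : Set ℂ := {z | z ≠ 0 ∧ |z.arg| = ω / 2}

/-- Membership in `𝕊^{λ,±}_{ℓ,n}` on a domain `D`: a real-linear combination of the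
functions `z^{λ−μ} z̄^{μ} log^q z` (for `0 ≤ μ ≤ ℓ`, `0 ≤ q ≤ n`) plus the conjugate
of such a combination. -/
def SbbHalf (lam : ℤ) (ℓ n : ℕ) (D : Set ℂ) (f : ℂ → ℂ) : Prop :=
  ∃ c d : ℕ → ℕ → ℝ, ∀ z ∈ D,
    f z = (∑ μ ∈ Finset.range (ℓ + 1), ∑ q ∈ Finset.range (n + 1),
            (c μ q : ℂ) * z ^ (lam - μ) * (conj z) ^ μ * (Complex.log z) ^ q)
        + conj (∑ μ ∈ Finset.range (ℓ + 1), ∑ q ∈ Finset.range (n + 1),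
            (d μ q : ℂ) * z ^ (lam - μ) * (conj z) ^ μ * (Complex.log z) ^ q)

/-- Membership in `𝕊^{λ}_{ℓ,n}`: a pair `(v, w)` with `v ∈ 𝕊^{λ,−}_{ℓ,n}` on the closed
sector `|arg z| ≤ ω/2` and `w ∈ 𝕊^{λ,+}_{ℓ,n}` on the closed sector `|arg z₊| ≤ π − ω/2`
(as a function of the variable `z₊ = −z`). -/
def SbbPair (ω : ℝ) (lam : ℤ) (ℓ n : ℕ) (v w : ℂ → ℂ) : Prop :=
  SbbHalf lam ℓ n {z | z ≠ 0 ∧ |z.arg| ≤ ω / 2} v ∧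
  SbbHalf lam ℓ n {z | z ≠ 0 ∧ |z.arg| ≤ π - ω / 2} w

section RealPolynomials

open Polynomial

/-- A complex polynomial with real top coefficient is the sum of a real polynomial and an
imaginary translate of a real polynomial, without increase of the degree. -/
lemma exists_real_add_translate {c : ℝ} (hc : c ≠ 0) (n : ℕ) (R : ℂ[X])
    (hR : R.natDegree ≤ n) (him : (R.coeff n).im = 0) :
    ∃ A B : ℝ[X], A.natDegree ≤ n ∧ B.natDegree ≤ n ∧
      ∀ x : ℂ, aeval x A + aeval (x + c * I) B = R.eval x := by
  induction n generalizing R with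
  | zero =>
    refine ⟨C (R.coeff 0).re, 0, by simp, by simp, fun x => ?_⟩
    have h : (((R.coeff 0).re : ℝ) : ℂ) = R.coeff 0 := Complex.ext (by simp) (by simp [him])
    rw [eq_C_of_natDegree_le_zero hR]
    simpa using h
  | succ n ih =>
    have hn : (n : ℝ) + 1 ≠ 0 := by positivity
    set r : ℝ := (R.coeff (n + 1)).re with hr
    set b : ℝ := (R.coeff n).im / ((n + 1) * c) with hb
    have hrR : (r : ℂ) = R.coeff (n + 1) := Complex.ext (by simp [hr]) (by simp [him])
    set R' : ℂ[X] := R - C (r : ℂ) * X ^ (n + 1)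
      - C (b : ℂ) * ((X + C (c * I)) ^ (n + 1) - X ^ (n + 1)) with hR'
    have hcoeff : R'.coeff (n + 1) = 0 := by
      simp [-map_mul, hR', coeff_X_add_C_pow, hrR]
    have hdeg : R'.natDegree ≤ n := by
      rw [natDegree_le_iff_coeff_eq_zero]
      intro N hN
      rcases (Nat.succ_le_of_lt hN).eq_or_lt with rfl | h
      · exact hcoeff
      · have h1 : R.coeff N = 0 := coeff_eq_zero_of_natDegree_lt (by omega)
        have h2 : N ≠ n + 1 := by omega
        simp [-map_mul, hR', coeff_X_add_C_pow, h1, coeff_X_pow, h2, Nat.choose_eq_zero_of_lt h]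
    have hreal : (R'.coeff n).im = 0 := by
      have h : R'.coeff n = R.coeff n - b * (c * I * (n + 1)) := by
        simp [-map_mul, hR', coeff_X_add_C_pow, coeff_X_pow]
      rw [h]
      have hbn : b * (c * (n + 1)) = (R.coeff n).im := by
        rw [hb]
        field_simp
      have h' : (b : ℂ) * (c * I * (n + 1)) = ((b * (c * (n + 1)) : ℝ) : ℂ) * I := by
        push_cast
        ring
      rw [h', hbn]
      simp
    obtain ⟨A, B, hA, hB, hAB⟩ := ih R' hdeg hreal
    refine ⟨A + C (r - b) * X ^ (n + 1), B + C b * X ^ (n + 1), ?_, ?_, fun x => ?_⟩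
    · exact natDegree_add_le_of_degree_le (by omega) (natDegree_C_mul_X_pow_le _ _)
    · exact natDegree_add_le_of_degree_le (by omega) (natDegree_C_mul_X_pow_le _ _)
    · have h := hAB x
      simp only [hR', eval_sub, eval_mul, eval_C, eval_pow, eval_X, eval_add] at h
      simp only [map_add, map_mul, map_pow, aeval_X, aeval_C, Complex.coe_algebraMap, map_sub]
      linear_combination h

/-- The equation `a P + P' = Q` is solvable in polynomials of degree at most `deg Q`
if `a ≠ 0`. -/
lemma exists_mul_add_derivative_eq {a : ℝ} (ha : a ≠ 0) (n : ℕ) (Q : ℝ[X])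
    (hQ : Q.natDegree ≤ n) :
    ∃ P : ℝ[X], P.natDegree ≤ n ∧ C a * P + derivative P = Q := by
  induction n generalizing Q with
  | zero =>
    refine ⟨C (Q.coeff 0 / a), by simp, ?_⟩
    rw [eq_C_of_natDegree_le_zero hQ, ← C_mul]
    simp [mul_div_cancel₀ _ ha]
  | succ n ih =>
    set q : ℝ := Q.coeff (n + 1) with hq
    set T : ℝ[X] := C (q / a) * X ^ (n + 1) with hT
    have hdT : derivative T = C (q / a * (n + 1)) * X ^ n := by
      rw [hT, derivative_C_mul_X_pow]
      simp
    have haT : C a * T = C q * X ^ (n + 1) := by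
      rw [hT, ← mul_assoc, ← C_mul, mul_div_cancel₀ _ ha]
    have hdeg : (Q - C a * T - derivative T).natDegree ≤ n := by
      rw [natDegree_le_iff_coeff_eq_zero]
      intro N hN
      have h2 : N ≠ n := by omega
      rw [haT, hdT, coeff_sub, coeff_sub, coeff_C_mul_X_pow, coeff_C_mul_X_pow, if_neg h2]
      rcases (Nat.succ_le_of_lt hN).eq_or_lt with rfl | h
      · simp [hq]
      · have h1 : Q.coeff N = 0 := coeff_eq_zero_of_natDegree_lt (by omega)
        simp [h1, h.ne']
    obtain ⟨P, hP, hPQ⟩ := ih _ hdeg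
    refine ⟨P + T, natDegree_add_le_of_degree_le (by omega) (natDegree_C_mul_X_pow_le _ _), ?_⟩
    rw [map_add]
    linear_combination hPQ

/-- The equation `a P + P' = q X ^ n` is always solvable in polynomials of degree at most
`n + 1`, and of degree at most `n` if `a ≠ 0`. -/
lemma exists_mul_add_derivative_eq_monomial (a q : ℝ) (n : ℕ) :
    ∃ P : ℝ[X], P.natDegree ≤ n + 1 ∧ (a ≠ 0 → P.natDegree ≤ n) ∧
      C a * P + derivative P = C q * X ^ n := by
  by_cases ha : a = 0
  · refine ⟨C (q / (n + 1)) * X ^ (n + 1), natDegree_C_mul_X_pow_le _ _,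
      fun h => absurd ha h, ?_⟩
    have hn : (n : ℝ) + 1 ≠ 0 := by positivity
    rw [derivative_C_mul_X_pow, ha]
    simp [div_mul_cancel₀ _ hn]
  · obtain ⟨P, hP, h⟩ := exists_mul_add_derivative_eq ha n (C q * X ^ n)
      (natDegree_C_mul_X_pow_le _ _)
    exact ⟨P, by omega, fun _ => hP, h⟩

/-- The function `z ^ a * P (log z)` for a real polynomial `P`. -/
def zpowLog (a : ℤ) (P : ℝ[X]) (z : ℂ) : ℂ := z ^ a * aeval (Complex.log z) P

lemma zpowLog_zero (a : ℤ) (z : ℂ) : zpowLog a 0 z = 0 := by simp [zpowLog]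

lemma zpowLog_conj (a : ℤ) (P : ℝ[X]) {z : ℂ} (hz : z ∈ slitPlane) :
    zpowLog a P (conj z) = conj (zpowLog a P z) := by
  rw [mem_slitPlane_iff_arg] at hz
  simp only [zpowLog, map_mul, map_zpow₀, Complex.log_conj z hz.1]
  rw [← Complex.conjAe_coe, aeval_algHom_apply]

lemma hasDerivAt_zpowLog (a : ℤ) (P : ℝ[X]) {z : ℂ} (hz : z ∈ slitPlane) :
    HasDerivAt (zpowLog a P)
      (zpowLog (a - 1) (C (a : ℝ) * P + derivative P) z) z := by
  have hz0 : z ≠ 0 := slitPlane_ne_zero hz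
  have h1 : HasDerivAt (fun x : ℂ => aeval x P) (aeval (Complex.log z) (derivative P))
      (Complex.log z) := P.hasDerivAt_aeval _
  have h := (hasDerivAt_zpow a z (Or.inl hz0)).mul (h1.comp z (Complex.hasDerivAt_log hz))
  refine h.congr_deriv ?_
  simp only [zpowLog, Function.comp, map_add, map_mul, aeval_C, Complex.coe_algebraMap,
    zpow_sub_one₀ hz0]
  push_cast
  ring

lemma zpowLog_eq_sum (a : ℤ) {P : ℝ[X]} {n : ℕ} (hP : P.natDegree ≤ n) (z : ℂ) :
    zpowLog a P z = ∑ q ∈ Finset.range (n + 1),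
      (P.coeff q : ℂ) * z ^ a * (Complex.log z) ^ q := by
  rw [zpowLog, aeval_eq_sum_range' (Nat.lt_succ_of_le hP), Finset.mul_sum]
  refine Finset.sum_congr rfl fun q _ => ?_
  rw [Complex.real_smul]
  ring

/-- The function `f` is real-differentiable at `z` with Wirtinger derivatives `p` and `q`. -/
def HasWirtingerAt (f : ℂ → ℂ) (p q z : ℂ) : Prop :=
  HasFDerivAt f (p • (1 : ℂ →L[ℝ] ℂ) + q • (conjCLE : ℂ →L[ℝ] ℂ)) z

namespace HasWirtingerAt

variable {f g : ℂ → ℂ} {p q p' q' z : ℂ}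

lemma wdz_eq (h : HasWirtingerAt f p q z) : wdz f z = p := by
  rw [wdz, HasFDerivAt.fderiv h]
  simp
  linear_combination (-(p - q) / 2) * I_mul_I

lemma wdzbar_eq (h : HasWirtingerAt f p q z) : wdzbar f z = q := by
  rw [wdzbar, HasFDerivAt.fderiv h]
  simp
  linear_combination ((p - q) / 2) * I_mul_I

lemma add (hf : HasWirtingerAt f p q z) (hg : HasWirtingerAt g p' q' z) :
    HasWirtingerAt (fun w => f w + g w) (p + p') (q + q') z := by
  refine (HasFDerivAt.add hf hg).congr_fderiv ?_
  ext
  simp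
  ring

lemma mul (hf : HasWirtingerAt f p q z) (hg : HasWirtingerAt g p' q' z) :
    HasWirtingerAt (fun w => f w * g w) (p * g z + f z * p') (q * g z + f z * q') z := by
  refine (HasFDerivAt.mul hf hg).congr_fderiv ?_
  ext
  simp
  ring

lemma of_hasDerivAt (hf : HasDerivAt f p z) : HasWirtingerAt f p 0 z := by
  refine (hf.hasFDerivAt.restrictScalars ℝ).congr_fderiv ?_
  ext
  simp [mul_comm]

lemma of_hasDerivAt_conj (hf : HasDerivAt f q (conj z)) :
    HasWirtingerAt (fun w => f (conj w)) 0 q z := by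
  have h1 : HasFDerivAt f _ (conjCLE z) := hf.hasFDerivAt.restrictScalars ℝ
  refine (h1.comp z (conjCLE : ℂ →L[ℝ] ℂ).hasFDerivAt).congr_fderiv ?_
  ext
  simp [mul_comm]

end HasWirtingerAt

lemma wdz_congr {f g : ℂ → ℂ} {z : ℂ} (h : f =ᶠ[nhds z] g) : wdz f z = wdz g z := by
  rw [wdz, wdz, h.fderiv_eq]

/-- The ansatz `z ^ a * A (log z) + z̄ ^ a * B (log z̄) + z̄ ^ k * z ^ (a - k) * P (log z)`. -/
def ansatz (a : ℤ) (k : ℕ) (A B P : ℝ[X]) (z : ℂ) : ℂ :=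
  zpowLog a A z + zpowLog a B (conj z) + (conj z) ^ k * zpowLog (a - k) P z

lemma conj_mem_slitPlane {z : ℂ} (hz : z ∈ slitPlane) : conj z ∈ slitPlane := by
  rw [mem_slitPlane_iff] at hz ⊢
  simpa using hz

lemma hasWirtingerAt_ansatz (a : ℤ) (k : ℕ) (A B P : ℝ[X]) {z : ℂ} (hz : z ∈ slitPlane) :
    HasWirtingerAt (ansatz a k A B P)
      (zpowLog (a - 1) (C (a : ℝ) * A + derivative A) z + (conj z) ^ k *
        zpowLog (a - k - 1) (C ((a - k : ℤ) : ℝ) * P + derivative P) z)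
      (zpowLog (a - 1) (C (a : ℝ) * B + derivative B) (conj z) +
        k * (conj z) ^ (k - 1) * zpowLog (a - k) P z) z := by
  have hA := HasWirtingerAt.of_hasDerivAt (hasDerivAt_zpowLog a A hz)
  have hB := HasWirtingerAt.of_hasDerivAt_conj
    (hasDerivAt_zpowLog a B (conj_mem_slitPlane hz))
  have hk := HasWirtingerAt.of_hasDerivAt_conj (hasDerivAt_pow k (conj z))
  have hP := HasWirtingerAt.of_hasDerivAt (hasDerivAt_zpowLog (a - k) P hz)
  have h := (hA.add hB).add (hk.mul hP)
  simp only [zero_mul, mul_zero, add_zero, zero_add] at h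
  exact h

lemma wdz_wdzbar_ansatz (a : ℤ) (k : ℕ) (A B P : ℝ[X]) {z : ℂ} (hz : z ∈ slitPlane) :
    wdz (wdzbar (ansatz a k A B P)) z = k * (conj z) ^ (k - 1) *
      zpowLog (a - k - 1) (C ((a - k : ℤ) : ℝ) * P + derivative P) z := by
  have hev : wdzbar (ansatz a k A B P) =ᶠ[nhds z] fun w =>
      zpowLog (a - 1) (C (a : ℝ) * B + derivative B) (conj w) +
        k * (conj w) ^ (k - 1) * zpowLog (a - k) P w := by
    filter_upwards [isOpen_slitPlane.mem_nhds hz] with w hw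
    exact (hasWirtingerAt_ansatz a k A B P hw).wdzbar_eq
  rw [wdz_congr hev]
  have hB := HasWirtingerAt.of_hasDerivAt_conj
    (hasDerivAt_zpowLog (a - 1) (C (a : ℝ) * B + derivative B) (conj_mem_slitPlane hz))
  have hk := HasWirtingerAt.of_hasDerivAt_conj
    ((hasDerivAt_pow (k - 1) (conj z)).const_mul (k : ℂ))
  have hP := HasWirtingerAt.of_hasDerivAt (hasDerivAt_zpowLog (a - k) P hz)
  rw [(hB.add (hk.mul hP)).wdz_eq]
  ring

lemma sbbHalf_ansatz (a : ℤ) (ℓ n : ℕ) {A B P : ℝ[X]} (hA : A.natDegree ≤ n)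
    (hB : B.natDegree ≤ n) (hP : P.natDegree ≤ n) {D : Set ℂ} (hD : D ⊆ slitPlane) :
    SbbHalf a ℓ n D (ansatz a ℓ A B P) := by
  refine ⟨fun μ q => (if μ = 0 then A.coeff q else 0) + (if μ = ℓ then P.coeff q else 0),
    fun μ q => if μ = 0 then B.coeff q else 0, fun z hz => ?_⟩
  rw [ansatz, zpowLog_conj a B (hD hz), zpowLog_eq_sum a hA, zpowLog_eq_sum a hB,
    zpowLog_eq_sum (a - ℓ) hP, add_right_comm]
  congr 1
  · push_cast
    simp only [add_mul, Finset.sum_add_distrib]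
    congr 1
    · symm
      rw [Finset.sum_eq_single 0 (by intro b _ hb; simp [hb]) (by simp)]
      simp
    · symm
      rw [Finset.sum_eq_single ℓ (by intro b _ hb; simp [hb]) (by simp), Finset.mul_sum]
      refine Finset.sum_congr rfl fun q _ => ?_
      simp
      ring
  · symm
    rw [Finset.sum_eq_single 0 (by intro b _ hb; simp [hb]) (by simp)]
    simp

lemma wdz_ansatz_conj (a : ℤ) (k : ℕ) (A B P : ℝ[X]) {z : ℂ} (hz : z ∈ slitPlane) :
    wdz (ansatz a k A B P) (conj z) = conj (wdz (ansatz a k A B P) z) := by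
  rw [(hasWirtingerAt_ansatz a k A B P hz).wdz_eq,
    (hasWirtingerAt_ansatz a k A B P (conj_mem_slitPlane hz)).wdz_eq]
  simp [zpowLog_conj _ _ hz]

lemma wdzbar_ansatz_conj (a : ℤ) (k : ℕ) (A B P : ℝ[X]) {z : ℂ} (hz : z ∈ slitPlane) :
    wdzbar (ansatz a k A B P) (conj z) = conj (wdzbar (ansatz a k A B P) z) := by
  rw [(hasWirtingerAt_ansatz a k A B P hz).wdzbar_eq,
    (hasWirtingerAt_ansatz a k A B P (conj_mem_slitPlane hz)).wdzbar_eq]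
  simp [zpowLog_conj _ _ hz]

lemma coeff_taylor_of_natDegree_le {n : ℕ} (r : ℂ) {f : ℂ[X]} (hf : f.natDegree ≤ n) :
    (taylor r f).coeff n = f.coeff n := by
  have h : (hasseDeriv n f).natDegree ≤ 0 := (natDegree_hasseDeriv_le f n).trans (by omega)
  rw [taylor_coeff, eq_C_of_natDegree_le_zero h, eval_C, hasseDeriv_coeff]
  simp

/-- Where `log (-z) = log z + c * I`, the derivatives of `z ^ a * A (log z)` and of
`z ^ a * B (log z)`, the latter taken at `-z`, can be made to sum to `z ^ (a - 1) * R (log z)`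
for any complex polynomial `R` with real top coefficient. -/
lemma exists_transmission_potentials {a : ℤ} (ha : a ≠ 0) {c : ℝ} (hc : c ≠ 0) (n : ℕ)
    (R : ℂ[X]) (hR : R.natDegree ≤ n) (him : (R.coeff n).im = 0) :
    ∃ A B : ℝ[X], A.natDegree ≤ n ∧ B.natDegree ≤ n ∧
      ∀ z : ℂ, z ≠ 0 → Complex.log (-z) = Complex.log z + c * I →
        zpowLog (a - 1) (C (a : ℝ) * A + derivative A) z +
          zpowLog (a - 1) (C (a : ℝ) * B + derivative B) (-z) =
        z ^ (a - 1) * R.eval (Complex.log z) := by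
  obtain ⟨A, B, hA, hB, hAB⟩ := exists_real_add_translate hc n R hR him
  have ha' : (a : ℝ) ≠ 0 := by exact_mod_cast ha
  set s : ℝ := (-1) ^ (a - 1) with hs
  have hss : s * s = 1 := by
    rw [hs, ← mul_zpow]
    simp
  obtain ⟨A', hA', hA''⟩ := exists_mul_add_derivative_eq ha' n A hA
  obtain ⟨B', hB', hB''⟩ := exists_mul_add_derivative_eq ha' n (C s * B)
    ((natDegree_C_mul_le _ _).trans hB)
  refine ⟨A', B', hA', hB', fun z hz hlog => ?_⟩
  rw [hA'', hB'', ← hAB, ← hlog, zpowLog, zpowLog, neg_eq_neg_one_mul z, mul_zpow]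
  have hsC : ((-1 : ℂ)) ^ (a - 1) = (s : ℂ) := by
    rw [hs]
    push_cast
    rfl
  have hssC : (s : ℂ) * s = 1 := by exact_mod_cast hss
  simp only [map_mul, aeval_C, Complex.coe_algebraMap, hsC]
  linear_combination (z ^ (a - 1) * aeval (Complex.log (-1 * z)) B) * hssC

end RealPolynomials

lemma log_neg_of_im_pos {z : ℂ} (h : 0 < z.im) :
    Complex.log (-z) = Complex.log z + ((-π : ℝ) : ℂ) * I := by
  rw [Complex.log, Complex.log, norm_neg, Complex.arg_neg_eq_arg_sub_pi_of_im_pos h]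
  push_cast
  ring

lemma log_neg_of_im_neg {z : ℂ} (h : z.im < 0) :
    Complex.log (-z) = Complex.log z + (π : ℂ) * I := by
  rw [Complex.log, Complex.log, norm_neg, Complex.arg_neg_eq_arg_add_pi_of_im_neg h]
  push_cast
  ring

lemma im_pos_of_arg_mem_Ioo {z : ℂ} (hz : z ≠ 0) (h : z.arg ∈ Ioo 0 π) : 0 < z.im := by
  rw [← Complex.norm_mul_sin_arg z]
  exact mul_pos (norm_pos_iff.2 hz) (Real.sin_pos_of_mem_Ioo h)

lemma eq_conj_mul_exp {z : ℂ} (h : z.arg ≠ π) : z = conj z * exp (2 * z.arg * I) := by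
  have h1 := Complex.norm_mul_exp_arg_mul_I (conj z)
  rw [Complex.arg_conj, if_neg h, norm_conj] at h1
  rw [← h1, mul_assoc, ← Complex.exp_add]
  conv_lhs => rw [← Complex.norm_mul_exp_arg_mul_I z]
  congr 2
  push_cast
  ring

lemma log_eq_log_conj_add {z : ℂ} (h : z.arg ≠ π) :
    Complex.log z = Complex.log (conj z) + 2 * z.arg * I := by
  rw [Complex.log, Complex.log, norm_conj, Complex.arg_conj, if_neg h]
  push_cast
  ring

lemma mem_slitPlane_of_abs_arg_lt {z : ℂ} (hz : z ≠ 0) (h : |z.arg| < π) : z ∈ slitPlane :=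
  mem_slitPlane_iff_arg.2 ⟨(lt_of_le_of_lt (le_abs_self _) h).ne, hz⟩

/-- Existence of a solution in `𝕊^{λ}_{ℓ+1,n+1}` of the generic transmission problem
with data `(f_n, g_n, h_n)` (corollary of Proposition `prop:prelim` and
Lemma `cor:ell'=1+k+2j`). -/
theorem stmt16 (ω : ℝ) (hω : ω ∈ Ioo 0 (2 * π)) (lam : ℤ) (hlam : lam ≠ 0)
    (ℓ n : ℕ) (α : ℝ) (β γ : ℂ) :
    ∃ V W : ℂ → ℂ,
      SbbPair ω lam (ℓ + 1) (n + 1) V W ∧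
      (∀ z ∈ Sminus ω, wdz (wdzbar V) z =
        (α : ℂ) * z ^ (lam - 2 - ℓ) * (conj z) ^ ℓ * (Complex.log z) ^ n) ∧
      (∀ zp ∈ SplusVar ω, wdz (wdzbar W) zp = 0) ∧
      (∀ z : ℂ, z ≠ 0 →
        (z.arg = ω / 2 →
          wdz V z + wdz W (-z) = β * z ^ (lam - 1) * (Complex.log z) ^ n ∧
          wdzbar V z + wdzbar W (-z)
            = γ * (conj z) ^ (lam - 1) * (Complex.log (conj z)) ^ n) ∧
        (z.arg = -(ω / 2) →
          wdz V z + wdz W (-z) = conj β * z ^ (lam - 1) * (Complex.log z) ^ n ∧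
          wdzbar V z + wdzbar W (-z)
            = conj γ * (conj z) ^ (lam - 1) * (Complex.log (conj z)) ^ n)) := by
  obtain ⟨hω0, hωπ⟩ := hω
  have hπ := Real.pi_pos
  set m : ℤ := lam - (ℓ + 1 : ℕ) with hm
  obtain ⟨P, hP, hPm, hPeq⟩ := exists_mul_add_derivative_eq_monomial (m : ℝ) (α / (ℓ + 1)) n
  set u : ℂ := exp (ω * I) with hu
  have hu0 : u ≠ 0 := Complex.exp_ne_zero _
  have hXn : ∀ b : ℂ, (Polynomial.C b * Polynomial.X ^ n).natDegree ≤ n := fun b =>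
    Polynomial.natDegree_C_mul_X_pow_le _ _
  set Rg : Polynomial ℂ :=
    Polynomial.C (β - u⁻¹ ^ (ℓ + 1) * (α / (ℓ + 1))) * Polynomial.X ^ n with hRg
  set PC : Polynomial ℂ := P.map (algebraMap ℝ ℂ) with hPC
  have hPCdeg : PC.natDegree ≤ n + 1 := Polynomial.natDegree_map_le.trans hP
  set Rh : Polynomial ℂ := Polynomial.C γ * Polynomial.X ^ n -
    Polynomial.C ((ℓ + 1) * u ^ m) * Polynomial.taylor (ω * I) PC with hRh
  have hRhdeg : Rh.natDegree ≤ n + 1 := by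
    refine (Polynomial.natDegree_sub_le_of_le ((hXn γ).trans n.le_succ)
      ((Polynomial.natDegree_C_mul_le _ _).trans ?_)).trans (max_self (n + 1)).le
    rwa [Polynomial.natDegree_taylor]
  have hRhim : (Rh.coeff (n + 1)).im = 0 := by
    have h : Rh.coeff (n + 1) = -((ℓ + 1) * u ^ m * (P.coeff (n + 1) : ℝ)) := by
      rw [hRh, Polynomial.coeff_sub, Polynomial.coeff_C_mul, Polynomial.coeff_C_mul,
        coeff_taylor_of_natDegree_le _ hPCdeg, hPC, Polynomial.coeff_map]
      simp [Polynomial.coeff_X_pow]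
    rw [h]
    by_cases hm0 : m = 0
    · simp [hm0]
    · have hc : P.coeff (n + 1) = 0 := Polynomial.coeff_eq_zero_of_natDegree_lt
        (Nat.lt_succ_of_le (hPm (by exact_mod_cast hm0)))
      simp [hc]
  obtain ⟨A, A', hA, hA', hAA'⟩ := exists_transmission_potentials hlam (neg_ne_zero.2 hπ.ne')
    (n + 1) Rg ((hXn _).trans n.le_succ) (by simp [hRg, -map_sub, -map_mul])
  obtain ⟨B, B', hB, hB', hBB'⟩ := exists_transmission_potentials hlam hπ.ne'
    (n + 1) Rh hRhdeg hRhim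
  set V := ansatz lam (ℓ + 1) A B P with hV
  set W := ansatz lam (ℓ + 1) A' B' 0 with hW
  have hray : ∀ z : ℂ, z ≠ 0 → z.arg = ω / 2 →
      z ∈ slitPlane ∧ -z ∈ slitPlane ∧
      wdz V z + wdz W (-z) = β * z ^ (lam - 1) * (Complex.log z) ^ n ∧
      wdzbar V z + wdzbar W (-z)
        = γ * (conj z) ^ (lam - 1) * (Complex.log (conj z)) ^ n := by
    intro z hz harg
    have him : 0 < z.im := im_pos_of_arg_mem_Ioo hz (by constructor <;> linarith)
    have hzs : z ∈ slitPlane := mem_slitPlane_iff.2 (Or.inr him.ne')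
    have hnzs : -z ∈ slitPlane := mem_slitPlane_iff.2 (Or.inr (by simpa using him.ne'))
    have hargπ : z.arg ≠ π := by linarith
    have h2 : (2 : ℂ) * z.arg * I = ω * I := by
      rw [harg]
      push_cast
      ring
    have hzu : z = conj z * u := by
      rw [hu, ← h2]
      exact eq_conj_mul_exp hargπ
    have hlogz : Complex.log z = Complex.log (conj z) + ω * I := by
      rw [← h2]
      exact log_eq_log_conj_add hargπ
    have hw0 : conj z ≠ 0 := by simpa using hz
    refine ⟨hzs, hnzs, ?_, ?_⟩
    · have h := hAA' z hz (log_neg_of_im_pos him)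
      rw [(hasWirtingerAt_ansatz _ _ _ _ _ hzs).wdz_eq,
        (hasWirtingerAt_ansatz _ _ _ _ _ hnzs).wdz_eq, ← hm, hPeq, mul_zero, zero_add,
        Polynomial.derivative_zero, zpowLog_zero, mul_zero, add_zero, add_right_comm, h]
      have hcz : conj z = z * u⁻¹ := by
        rw [eq_mul_inv_iff_mul_eq₀ hu0]
        exact hzu.symm
      have hpow : z ^ (ℓ + 1) * z ^ (m - 1) = z ^ (lam - 1) := by
        rw [← zpow_natCast, ← zpow_add₀ hz]
        congr 1
        omega
      simp only [hcz, zpowLog, hRg, map_mul, map_pow, Polynomial.aeval_C, Polynomial.aeval_X,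
        Complex.coe_algebraMap, Polynomial.eval_mul, Polynomial.eval_C, Polynomial.eval_pow,
        Polynomial.eval_X, mul_pow, ← hpow]
      push_cast
      ring
    · have h := hBB' (conj z) hw0 (log_neg_of_im_neg (by simpa using him))
      rw [(hasWirtingerAt_ansatz _ _ _ _ _ hzs).wdzbar_eq,
        (hasWirtingerAt_ansatz _ _ _ _ _ hnzs).wdzbar_eq, ← hm, zpowLog_zero, mul_zero,
        add_zero, add_right_comm, map_neg, h]
      have hpow : conj z ^ ℓ * conj z ^ m = conj z ^ (lam - 1) := by
        rw [← zpow_natCast, ← zpow_add₀ hw0]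
        congr 1
        omega
      have hPz : zpowLog m P z = conj z ^ m * u ^ m *
          Polynomial.eval (Complex.log (conj z)) (Polynomial.taylor (ω * I) PC) := by
        rw [Polynomial.taylor_eval, ← mul_zpow, ← hzu, hPC, Polynomial.eval_map_algebraMap,
          ← hlogz, zpowLog]
      rw [hPz, ← hpow, hRh]
      simp only [Polynomial.eval_sub, Polynomial.eval_mul, Polynomial.eval_C,
        Polynomial.eval_pow, Polynomial.eval_X, add_tsub_cancel_right]
      push_cast
      ring
  refine ⟨V, W, ⟨?_, ?_⟩, ?_, ?_, ?_⟩
  · exact sbbHalf_ansatz lam (ℓ + 1) (n + 1) hA hB hP fun z hz =>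
      mem_slitPlane_of_abs_arg_lt hz.1 (hz.2.trans_lt (by linarith))
  · exact sbbHalf_ansatz lam (ℓ + 1) (n + 1) hA' hB' (by simp) fun z hz =>
      mem_slitPlane_of_abs_arg_lt hz.1 (hz.2.trans_lt (by linarith))
  · intro z hz
    rw [wdz_wdzbar_ansatz _ _ _ _ _
      (mem_slitPlane_of_abs_arg_lt hz.1 (hz.2.trans (by linarith))), ← hm, hPeq]
    have hexp : m - 1 = lam - 2 - ℓ := by omega
    simp only [zpowLog, map_mul, map_pow, Polynomial.aeval_C, Polynomial.aeval_X,
      Complex.coe_algebraMap, hexp, add_tsub_cancel_right]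
    push_cast
    field_simp
  · intro z hz
    rw [wdz_wdzbar_ansatz _ _ _ _ _
      (mem_slitPlane_of_abs_arg_lt hz.1 (hz.2.trans (by linarith)))]
    simp [zpowLog_zero]
  · intro z hz
    refine ⟨fun harg => (hray z hz harg).2.2, fun harg => ?_⟩
    have hargπ : z.arg ≠ π := by linarith
    obtain ⟨hw, hnw, h1, h2⟩ := hray (conj z) (by simpa using hz) (by
      rw [Complex.arg_conj, if_neg hargπ, harg, neg_neg])
    have hlog : Complex.log (conj z) = conj (Complex.log z) := Complex.log_conj z hargπ
    constructor
    · have h : wdz V z + wdz W (-z) = conj (wdz V (conj z) + wdz W (-conj z)) := by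
        rw [map_add, ← wdz_ansatz_conj _ _ _ _ _ hw, ← wdz_ansatz_conj _ _ _ _ _ hnw, map_neg,
          Complex.conj_conj]
      rw [h, h1]
      simp [hlog]
    · have h : wdzbar V z + wdzbar W (-z) =
          conj (wdzbar V (conj z) + wdzbar W (-conj z)) := by
        rw [map_add, ← wdzbar_ansatz_conj _ _ _ _ _ hw, ← wdzbar_ansatz_conj _ _ _ _ _ hnw,
          map_neg, Complex.conj_conj]
      rw [h, h2]
      simp [hlog]
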